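/- arXiv:2406.16336 — 5 statements merged into one kernel-verified Lean document; each statement's English description precedes it below -/
import Mathlib

section
/- Let n be a natural number with n ≥ 1. If A is a matrix in SO(3) with tr(A) = 1 + 2·cos(2π/n), then Aⁿ = 1 (the identity matrix). -/
open Matrix

namespace Matrix

variable {R : Type*} [CommRing R]

/-- The Cayley–Hamilton theorem for `3 × 3` matrices, in explicit form. -/
theorem pow_three_fin_three (A : Matrix (Fin 3) (Fin 3) R) :
    A ^ 3 = A.trace • A ^ 2 - A.adjugate.trace • A + A.det • (1 : Matrix (Fin 3) (Fin 3) R) := by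
  ext i j
  fin_cases i <;> fin_cases j <;>
    simp [pow_succ, mul_apply, Fin.sum_univ_three, trace_fin_three, adjugate_fin_three,
      det_fin_three] <;> ring

theorem trace_sq_fin_three (A : Matrix (Fin 3) (Fin 3) R) :
    (A ^ 2).trace = A.trace ^ 2 - 2 * A.adjugate.trace := by
  simp [pow_succ, mul_apply, Fin.sum_univ_three, trace_fin_three, adjugate_fin_three]
  ring

theorem adjugate_eq_transpose_of_transpose_mul_self {m : Type*} [Fintype m] [DecidableEq m]
    {A : Matrix m m R} (hA : Aᵀ * A = 1) (hdet : A.det = 1) : A.adjugate = Aᵀ := by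
  have h : A.adjugate * A = 1 := by rw [adjugate_mul, hdet, one_smul]
  exact left_inv_eq_right_inv h (mul_eq_one_comm.mp hA)

theorem transpose_pow_mul_pow_self {m : Type*} [Fintype m] [DecidableEq m]
    {A : Matrix m m R} (hA : Aᵀ * A = 1) (k : ℕ) : (A ^ k)ᵀ * A ^ k = 1 := by
  have h : Commute Aᵀ A := hA.trans (mul_eq_one_comm.mp hA).symm
  rw [transpose_pow, ← h.mul_pow, hA, one_pow]

/-- A real orthogonal matrix whose trace is that of the identity is the identity. -/
theorem eq_one_of_transpose_mul_self_of_trace {m : Type*} [Fintype m] [DecidableEq m]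
    {B : Matrix m m ℝ} (hB : Bᵀ * B = 1) (htr : B.trace = Fintype.card m) : B = 1 := by
  rw [← sub_eq_zero, ← trace_conjTranspose_mul_self_eq_zero_iff,
    conjTranspose_eq_transpose_of_trivial, transpose_sub, transpose_one, sub_mul, mul_sub, mul_sub,
    hB]
  simp [htr]

/-- The powers of a rotation of `ℝ³` by the angle `θ` have the traces of rotations by the
multiples of `θ`. -/
theorem trace_pow_of_trace_eq_one_add_two_mul_cos {A : Matrix (Fin 3) (Fin 3) ℝ}
    (hA : Aᵀ * A = 1) (hdet : A.det = 1) {θ : ℝ} (htr : A.trace = 1 + 2 * Real.cos θ) :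
    ∀ k : ℕ, (A ^ k).trace = 1 + 2 * Real.cos (k * θ)
  | 0 => by norm_num
  | 1 => by simpa using htr
  | 2 => by
    rw [trace_sq_fin_three, adjugate_eq_transpose_of_transpose_mul_self hA hdet, trace_transpose,
      htr, Nat.cast_ofNat, Real.cos_two_mul]
    ring
  | k + 3 => by
    have hrec : A ^ (k + 3) = A.trace • A ^ (k + 2) - A.trace • A ^ (k + 1) + A ^ k := by
      rw [pow_add, pow_three_fin_three, adjugate_eq_transpose_of_transpose_mul_self hA hdet,
        trace_transpose, hdet, mul_add, mul_sub, mul_smul_comm, mul_smul_comm, mul_smul_comm,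
        ← pow_add, ← pow_succ, mul_one, one_smul]
    have hcos (x : ℝ) : Real.cos (x + θ) + Real.cos (x - θ) = 2 * Real.cos θ * Real.cos x := by
      rw [Real.cos_add, Real.cos_sub]
      ring
    have h₁ := hcos ((k + 1) * θ)
    have h₂ := hcos ((k + 2) * θ)
    rw [show ((k : ℝ) + 1) * θ + θ = (k + 2) * θ by ring,
      show ((k : ℝ) + 1) * θ - θ = k * θ by ring] at h₁
    rw [show ((k : ℝ) + 2) * θ + θ = (k + 3) * θ by ring,
      show ((k : ℝ) + 2) * θ - θ = (k + 1) * θ by ring] at h₂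
    rw [hrec, trace_add, trace_sub, trace_smul, trace_smul, smul_eq_mul, smul_eq_mul, htr,
      trace_pow_of_trace_eq_one_add_two_mul_cos hA hdet htr k,
      trace_pow_of_trace_eq_one_add_two_mul_cos hA hdet htr (k + 1),
      trace_pow_of_trace_eq_one_add_two_mul_cos hA hdet htr (k + 2)]
    push_cast
    linear_combination 2 * h₁ - 2 * h₂

end Matrix

/-- If `A ∈ SO(3)` has trace `1 + 2 cos (2π/n)` with `n ≥ 1`, then `Aⁿ = 1`. -/
theorem pow_eq_one_of_trace_SO3 (n : ℕ) (hn : 1 ≤ n) (A : Matrix (Fin 3) (Fin 3) ℝ)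
    (hA : Aᵀ * A = 1) (hdet : A.det = 1)
    (htr : A.trace = 1 + 2 * Real.cos (2 * Real.pi / n)) :
    A ^ n = 1 := by
  refine eq_one_of_transpose_mul_self_of_trace (transpose_pow_mul_pow_self hA n) ?_
  have hn₀ : (n : ℝ) ≠ 0 := by positivity
  rw [trace_pow_of_trace_eq_one_add_two_mul_cos hA hdet htr, mul_div_cancel₀ _ hn₀,
    Real.cos_two_pi]
  norm_num
end

section
/- Let f : ℝ → SO(3) be a continuous map with f(0) = 1, and suppose there exists σ₀ ∈ ℝ with f(σ₀) ≠ 1. Then there exist σ ∈ ℝ and a natural number n with n ≥ 2 such that f(σ) ≠ 1 and f(σ)ⁿ = 1. -/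
open Matrix

/-- In a real algebra, an element annihilated by `(X - 1) * (X ^ 2 - 2 * cos (2 * π / n) * X + 1)`
has `n`-th power equal to `1`. -/
lemma pow_eq_one_of_rotation_relation {A : Type*} [Ring A] [Algebra ℝ A] (x : A) {n : ℕ}
    (hn : 3 ≤ n)
    (hx : (x - 1) * (x ^ 2 - (2 * Real.cos (2 * Real.pi / n)) • x + 1) = 0) :
    x ^ n = 1 := by
  set θ : ℝ := 2 * Real.pi / n with hθ
  have hn' : (3 : ℝ) ≤ n := by exact_mod_cast hn
  have hnθ : n * θ = 2 * Real.pi := by rw [hθ]; field_simp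
  have hθ_pos : 0 < θ := by positivity
  have hθ_lt : θ < Real.pi := by nlinarith [Real.pi_pos]
  have hs : Real.sin θ ≠ 0 := (Real.sin_pos_of_pos_of_lt_pi hθ_pos hθ_lt).ne'
  have hc : 2 - 2 * Real.cos θ ≠ 0 := by
    intro h
    have := Real.sin_sq_add_cos_sq θ
    rw [show Real.cos θ = 1 by linarith] at this
    exact hs (by nlinarith)
  set c : ℝ := Real.cos θ with hcdef
  set p : A := x ^ 2 - (2 * c) • x + 1 with hp
  have hxp : x * p = p := by rwa [sub_mul, one_mul, sub_eq_zero] at hx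
  set r : A := (2 - 2 * c) • (1 : A) - p with hr
  have hxxp : x * (x * p) = p := by rw [hxp, hxp]
  have hxxr : x * (x * r) = (2 * c) • (x * r) - r := by
    have h : x * (x * r) = (2 - 2 * c) • (x ^ 2) - p := by
      rw [hr, mul_sub, mul_sub, hxxp, mul_smul_comm, mul_smul_comm, mul_one, pow_two]
    have h' : x * r = (2 - 2 * c) • x - p := by
      rw [hr, mul_sub, hxp, mul_smul_comm, mul_one]
    have hx2 : x ^ 2 = p + (2 * c) • x - 1 := by rw [hp]; abel
    rw [h, h', hr, hx2]
    module
  have hpow_p (k : ℕ) : x ^ k * p = p := by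
    induction k with
    | zero => simp
    | succ k ih => rw [pow_succ, mul_assoc, hxp, ih]
  have hpow_r (k : ℕ) : Real.sin θ • (x ^ (k + 1) * r) =
      Real.sin ((k + 1) * θ) • (x * r) - Real.sin (k * θ) • r := by
    induction k with
    | zero => simp
    | succ k ih =>
      have hsin : Real.sin ((k + 1 + 1) * θ) =
          2 * c * Real.sin ((k + 1) * θ) - Real.sin (k * θ) := by
        rw [show ((k : ℝ) + 1 + 1) * θ = (k + 1) * θ + θ by ring,
          show (k : ℝ) * θ = (k + 1) * θ - θ by ring, Real.sin_add, Real.sin_sub]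
        ring
      rw [pow_succ', mul_assoc, ← mul_smul_comm, ih, mul_sub, mul_smul_comm, mul_smul_comm, hxxr]
      push_cast
      rw [hsin]
      module
  have hr_fixed : x ^ n * r = r := by
    obtain ⟨m, rfl⟩ : ∃ m, n = m + 1 := ⟨n - 1, by omega⟩
    have h := hpow_r m
    push_cast at hnθ
    rw [hnθ, show (m : ℝ) * θ = 2 * Real.pi - θ by linarith, Real.sin_two_pi,
      Real.sin_two_pi_sub, zero_smul, zero_sub, neg_smul, neg_neg] at h
    exact smul_right_injective A hs h
  have hsum : (2 - 2 * c) • (1 : A) = r + p := by rw [hr]; abel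
  refine smul_right_injective A hc ?_
  change (2 - 2 * c) • x ^ n = (2 - 2 * c) • (1 : A)
  rw [← mul_one (x ^ n), ← mul_smul_comm, hsum, mul_add, hr_fixed, hpow_p]

lemma sq_sub_trace_smul_add_eq_adjugate {R : Type*} [CommRing R] (A : Matrix (Fin 3) (Fin 3) R) :
    A ^ 2 - A.trace • A + A.adjugate.trace • (1 : Matrix (Fin 3) (Fin 3) R) = A.adjugate := by
  rw [adjugate_fin_three]
  ext i j
  fin_cases i <;> fin_cases j <;>
    simp [pow_two, mul_apply, trace_fin_three, Fin.sum_univ_three] <;> ring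

lemma adjugate_eq_transpose_of_special_orthogonal {ι R : Type*} [Fintype ι] [DecidableEq ι]
    [CommRing R] {A : Matrix ι ι R} (hA : Aᵀ * A = 1) (hdet : A.det = 1) : A.adjugate = Aᵀ := by
  calc A.adjugate = Aᵀ * A * A.adjugate := by rw [hA, one_mul]
    _ = Aᵀ := by rw [mul_assoc, mul_adjugate, hdet, one_smul, mul_one]

lemma special_orthogonal_three_relation {R : Type*} [CommRing R] {A : Matrix (Fin 3) (Fin 3) R}
    (hA : Aᵀ * A = 1) (hdet : A.det = 1) :
    (A - 1) * (A ^ 2 - (A.trace - 1) • A + 1) = 0 := by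
  have h := congrArg (A * ·) (sq_sub_trace_smul_add_eq_adjugate A)
  simp only [adjugate_eq_transpose_of_special_orthogonal hA hdet, trace_transpose,
    mul_eq_one_comm.mp hA, mul_add, mul_sub, mul_smul_comm, mul_one] at h
  rw [sub_mul, one_mul, mul_add, mul_sub, mul_smul_comm, mul_one, ← sub_eq_zero.mpr h,
    ← pow_two]
  module

lemma diag_le_one_of_orthogonal {ι : Type*} [Fintype ι] [DecidableEq ι] {A : Matrix ι ι ℝ}
    (hA : Aᵀ * A = 1) (i : ι) : A i i ≤ 1 := by
  have h : ∑ k, A k i * A k i = 1 := by simpa [mul_apply] using congrFun₂ hA i i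
  have := Finset.single_le_sum (f := fun k => A k i * A k i)
    (fun k _ => mul_self_nonneg _) (Finset.mem_univ i)
  nlinarith

lemma trace_lt_card_of_orthogonal {ι : Type*} [Fintype ι] [DecidableEq ι] {A : Matrix ι ι ℝ}
    (hA : Aᵀ * A = 1) (hne : A ≠ 1) : A.trace < Fintype.card ι := by
  have hle : A.trace ≤ ∑ _i : ι, (1 : ℝ) :=
    Finset.sum_le_sum fun i _ => diag_le_one_of_orthogonal hA i
  rw [Finset.sum_const, Finset.card_univ, nsmul_eq_mul, mul_one] at hle
  refine hle.lt_of_ne fun heq => hne ?_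
  have hzero : ((A - 1)ᵀ * (A - 1)).trace = 0 := by
    rw [transpose_sub, transpose_one, sub_mul, mul_sub, hA]
    simp [trace_sub, heq]
  rw [← conjTranspose_eq_transpose_of_trivial, trace_conjTranspose_mul_self_eq_zero_iff] at hzero
  exact sub_eq_zero.mp hzero

lemma exists_lt_one_add_two_mul_cos {t : ℝ} (ht : t < 3) :
    ∃ n : ℕ, 3 ≤ n ∧ t < 1 + 2 * Real.cos (2 * Real.pi / n) := by
  have hlim : Filter.Tendsto (fun n : ℕ => 1 + 2 * Real.cos (2 * Real.pi / n)) Filter.atTop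
      (nhds (1 + 2 * Real.cos 0)) :=
    (((Real.continuous_cos.tendsto 0).comp
      (tendsto_const_div_atTop_nhds_zero_nat (2 * Real.pi))).const_mul 2).const_add 1
  have hev := hlim.eventually_const_lt (show t < 1 + 2 * Real.cos 0 by rw [Real.cos_zero]; linarith)
  exact ((Filter.eventually_ge_atTop 3).and hev).exists

/-- If `f : ℝ → SO(3)` is continuous, `f 0 = 1`, and `f σ₀ ≠ 1` for some `σ₀`,
then there exist `σ` and `n ≥ 2` with `f σ ≠ 1` and `(f σ)ⁿ = 1`. -/
theorem exists_nontrivial_finite_order_SO3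
    (f : ℝ → Matrix (Fin 3) (Fin 3) ℝ)
    (hSO : ∀ σ : ℝ, (f σ)ᵀ * f σ = 1 ∧ (f σ).det = 1)
    (hcont : Continuous f) (h0 : f 0 = 1)
    (hne : ∃ σ₀ : ℝ, f σ₀ ≠ 1) :
    ∃ σ : ℝ, ∃ n : ℕ, 2 ≤ n ∧ f σ ≠ 1 ∧ (f σ) ^ n = 1 := by
  obtain ⟨σ₀, hσ₀⟩ := hne
  have hlt : (f σ₀).trace < 3 := by simpa using trace_lt_card_of_orthogonal (hSO σ₀).1 hσ₀
  obtain ⟨n, hn, hcos⟩ := exists_lt_one_add_two_mul_cos hlt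
  have htrace0 : (f 0).trace = 3 := by simp [h0]
  obtain ⟨σ, hσ⟩ := intermediate_value_univ σ₀ 0 hcont.matrix_trace
    ⟨hcos.le, by rw [htrace0]; linarith [Real.cos_le_one (2 * Real.pi / n)]⟩
  refine ⟨σ, n, by omega, fun h => ?_, pow_eq_one_of_rotation_relation _ hn ?_⟩
  · have hcos1 : Real.cos (2 * Real.pi / n) = 1 := by
      simp only [h, trace_one, Fintype.card_fin] at hσ
      push_cast at hσ
      linarith
    have hn' : (3 : ℝ) ≤ n := by exact_mod_cast hn
    have hpi := Real.pi_pos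
    have hlt2 : 2 * Real.pi / n < 2 * Real.pi := div_lt_self (by positivity) (by linarith)
    have := (Real.cos_eq_one_iff_of_lt_of_lt (by linarith [show 0 < 2 * Real.pi / n by positivity])
      hlt2).mp hcos1
    exact absurd this (by positivity)
  · have h := special_orthogonal_three_relation (hSO σ).1 (hSO σ).2
    rwa [show (f σ).trace = _ from hσ, add_sub_cancel_left] at h
end

section
/- Let f : ℝ → SO(3) be a continuous map with f(0) = 1, and suppose there exists σ₀ ∈ ℝ with f(σ₀) ≠ 1. Then there exists a natural number N such that for every natural number n ≥ N there exists σ ∈ ℝ with f(σ) ≠ 1 and f(σ)ⁿ = 1. -/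
open Matrix

namespace Matrix

section CommRing

variable {R : Type*} [CommRing R]

theorem adjugate_fin_three_eq_sq_sub_trace_smul (A : Matrix (Fin 3) (Fin 3) R) :
    A.adjugate = A * A - A.trace • A + A.adjugate.trace • 1 := by
  ext i j
  fin_cases i <;> fin_cases j <;>
    simp [adjugate_fin_three, trace_fin_three, mul_apply, Fin.sum_univ_three] <;> ring

theorem adjugate_eq_transpose_of_det_eq_one {n : Type*} [Fintype n] [DecidableEq n]
    {A : Matrix n n R} (hA : Aᵀ * A = 1) (hdet : A.det = 1) : A.adjugate = Aᵀ := by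
  calc A.adjugate = Aᵀ * A * A.adjugate := by rw [hA, one_mul]
    _ = Aᵀ := by rw [mul_assoc, mul_adjugate, hdet, one_smul, mul_one]

/-- The Cayley–Hamilton relation in `SO(3)`, with the eigenvalue `1` factored out. -/
theorem sq_mul_sub_one_of_det_eq_one {A : Matrix (Fin 3) (Fin 3) R}
    (hA : Aᵀ * A = 1) (hdet : A.det = 1) :
    A * (A * (A - 1)) = (A.trace - 1) • (A * (A - 1)) - (A - 1) := by
  have h := congrArg (· * A) (adjugate_fin_three_eq_sq_sub_trace_smul A)
  simp only [adjugate_eq_transpose_of_det_eq_one hA hdet, hA, trace_transpose, add_mul, sub_mul,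
    smul_mul_assoc, one_mul] at h
  simp only [mul_sub, mul_one, ← mul_assoc]
  linear_combination (norm := module) -h

end CommRing

theorem sum_sq_sub_one_eq_six_sub_two_mul_trace {A : Matrix (Fin 3) (Fin 3) ℝ}
    (hA : Aᵀ * A = 1) : ∑ i, ∑ j, (A - 1) i j ^ 2 = 6 - 2 * A.trace := by
  have h : (Aᵀ * A).trace = 3 := by simp [hA]
  simp [trace_fin_three, mul_apply, Fin.sum_univ_three] at h ⊢
  linear_combination h

theorem trace_lt_three_of_ne_one {A : Matrix (Fin 3) (Fin 3) ℝ}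
    (hA : Aᵀ * A = 1) (hne : A ≠ 1) : A.trace < 3 := by
  by_contra! ht
  have h := sum_sq_sub_one_eq_six_sub_two_mul_trace hA
  have hnn : ∀ i, 0 ≤ ∑ j, (A - 1) i j ^ 2 := fun i => Finset.sum_nonneg fun j _ => sq_nonneg _
  have h_zero : ∑ i, ∑ j, (A - 1) i j ^ 2 = 0 :=
    le_antisymm (by linarith) (Finset.sum_nonneg fun i _ => hnn i)
  refine hne (sub_eq_zero.mp ?_)
  ext i j
  have hi := (Finset.sum_eq_zero_iff_of_nonneg fun i _ => hnn i).mp h_zero i (Finset.mem_univ i)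
  have hij := (Finset.sum_eq_zero_iff_of_nonneg fun j _ => sq_nonneg _).mp hi j (Finset.mem_univ j)
  exact pow_eq_zero_iff two_ne_zero |>.mp hij

/-- An explicit formula for the powers of a rotation of angle `θ` in terms of
`A * (A - 1)` and `A - 1`. -/
theorem smul_pow_sub_one_of_trace_eq {A : Matrix (Fin 3) (Fin 3) ℝ}
    (hA : Aᵀ * A = 1) (hdet : A.det = 1) {θ : ℝ} (ht : A.trace = 1 + 2 * Real.cos θ) (k : ℕ) :
    (2 * (1 - Real.cos θ) * Real.sin θ) • (A ^ k - 1) =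
      (Real.sin θ - Real.sin θ * Real.cos (k * θ) + (Real.cos θ - 1) * Real.sin (k * θ)) •
          (A * (A - 1)) +
        (2 * (1 - Real.cos θ) * Real.sin θ - Real.sin θ +
          Real.sin θ * (Real.cos (k * θ) * Real.cos θ + Real.sin (k * θ) * Real.sin θ) -
          (Real.cos θ - 1) * (Real.sin (k * θ) * Real.cos θ - Real.cos (k * θ) * Real.sin θ)) •
          (A - 1) := by
  have hrel := sq_mul_sub_one_of_det_eq_one hA hdet
  rw [ht, add_sub_cancel_left] at hrel
  have hsq := Real.sin_sq_add_cos_sq θ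
  induction k with
  | zero =>
    simp only [pow_zero, sub_self, smul_zero, Nat.cast_zero, zero_mul, Real.cos_zero, Real.sin_zero]
    module
  | succ k ih =>
    have hstep : A ^ (k + 1) - 1 = A * (A ^ k - 1) + (A - 1) := by
      rw [pow_succ', mul_sub, mul_one]; abel
    rw [hstep, smul_add, ← mul_smul_comm, ih, mul_add, mul_smul_comm, mul_smul_comm, hrel]
    push_cast
    rw [add_mul, one_mul, Real.cos_add, Real.sin_add]
    generalize Real.sin (k * θ) = S
    generalize Real.cos (k * θ) = C
    generalize Real.sin θ = s at *
    generalize Real.cos θ = c at *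
    generalize A * (A - 1) = X
    generalize A - 1 = Y
    match_scalars
    · ring
    · linear_combination ((c - 1) * S - s * C) * hsq

theorem pow_eq_one_of_trace_eq {A : Matrix (Fin 3) (Fin 3) ℝ}
    (hA : Aᵀ * A = 1) (hdet : A.det = 1) {n : ℕ} (hn : 3 ≤ n)
    (ht : A.trace = 1 + 2 * Real.cos (2 * Real.pi / n)) : A ^ n = 1 := by
  have hn' : (3 : ℝ) ≤ n := by exact_mod_cast hn
  have hsin : 0 < Real.sin (2 * Real.pi / n) := by
    apply Real.sin_pos_of_pos_of_lt_pi
    · positivity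
    · rw [div_lt_iff₀ (by linarith)]
      nlinarith [Real.pi_pos]
  have hcos : Real.cos (2 * Real.pi / n) < 1 := by
    nlinarith [Real.sin_sq_add_cos_sq (2 * Real.pi / n)]
  have h := smul_pow_sub_one_of_trace_eq hA hdet ht n
  rw [mul_div_cancel₀ _ (by linarith : (n : ℝ) ≠ 0), Real.cos_two_pi, Real.sin_two_pi] at h
  have h_zero : (2 * (1 - Real.cos (2 * Real.pi / n)) * Real.sin (2 * Real.pi / n)) •
      (A ^ n - 1) = 0 := by
    rw [h]; module
  have hpos : 0 < 2 * (1 - Real.cos (2 * Real.pi / n)) * Real.sin (2 * Real.pi / n) :=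
    mul_pos (by linarith) hsin
  exact sub_eq_zero.mp ((smul_eq_zero.mp h_zero).resolve_left hpos.ne')

end Matrix

/-- If `f : ℝ → SO(3)` is continuous, `f 0 = 1`, and `f σ₀ ≠ 1` for some `σ₀`,
then for every sufficiently large `n` there is a `σ` with `f σ ≠ 1` and `(f σ)ⁿ = 1`. -/
theorem eventually_exists_nontrivial_order_dvd_SO3
    (f : ℝ → Matrix (Fin 3) (Fin 3) ℝ)
    (hSO : ∀ σ : ℝ, (f σ)ᵀ * f σ = 1 ∧ (f σ).det = 1)
    (hcont : Continuous f) (h0 : f 0 = 1)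
    (hne : ∃ σ₀ : ℝ, f σ₀ ≠ 1) :
    ∃ N : ℕ, ∀ n : ℕ, N ≤ n → ∃ σ : ℝ, f σ ≠ 1 ∧ (f σ) ^ n = 1 := by
  obtain ⟨σ₀, hσ₀⟩ := hne
  have hlt := trace_lt_three_of_ne_one (hSO σ₀).1 hσ₀
  have hlim : Filter.Tendsto (fun n : ℕ => 1 + 2 * Real.cos (2 * Real.pi / n)) Filter.atTop
      (nhds 3) := by
    have h := ((Real.continuous_cos.tendsto 0).comp
      (tendsto_const_div_atTop_nhds_zero_nat (2 * Real.pi))).const_mul 2 |>.const_add 1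
    rw [Real.cos_zero] at h
    norm_num at h
    exact h
  obtain ⟨N, hN⟩ := Filter.eventually_atTop.mp (hlim.eventually_const_lt hlt)
  refine ⟨max N 3, fun n hn => ?_⟩
  have hn3 : 3 ≤ n := le_of_max_le_right hn
  have hn' : (3 : ℝ) ≤ n := by exact_mod_cast hn3
  have hcos : Real.cos (2 * Real.pi / n) < 1 := by
    rw [← Real.cos_zero]
    apply Real.cos_lt_cos_of_nonneg_of_le_pi le_rfl
    · rw [div_le_iff₀ (by linarith)]
      nlinarith [Real.pi_pos]
    · positivity
  obtain ⟨σ, hσ⟩ := mem_range_of_exists_le_of_exists_ge hcont.matrix_trace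
    ⟨σ₀, (hN n (le_of_max_le_left hn)).le⟩
    ⟨0, by simp only [h0, trace_one, Fintype.card_fin]; push_cast; linarith⟩
  refine ⟨σ, fun h => ?_, pow_eq_one_of_trace_eq (hSO σ).1 (hSO σ).2 hn3 hσ⟩
  simp only [h, trace_one, Fintype.card_fin] at hσ
  push_cast at hσ
  linarith
end

section
/- Let p and q be quaternions with ‖p‖ = 1 and ‖q‖ = 1. Then re(star(q) · star(p) · q · p) ≥ 2·(re q)² − 1. -/
open Quaternion

/-- The gap in the commutator inequality, as a sum of squares. -/
theorem re_commutator_eq_add_sq (p q : Quaternion ℝ) (hp : ‖p‖ = 1) (hq : ‖q‖ = 1) :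
    (star q * star p * q * p).re = 2 * q.re ^ 2 - 1 +
      2 * (p.re ^ 2 * (q.imI ^ 2 + q.imJ ^ 2 + q.imK ^ 2) +
        (p.imI * q.imI + p.imJ * q.imJ + p.imK * q.imK) ^ 2) := by
  have hP : p.re ^ 2 + p.imI ^ 2 + p.imJ ^ 2 + p.imK ^ 2 = 1 := by
    rw [← normSq_def', normSq_eq_norm_mul_self, hp, one_mul]
  have hQ : q.re ^ 2 + q.imI ^ 2 + q.imJ ^ 2 + q.imK ^ 2 = 1 := by
    rw [← normSq_def', normSq_eq_norm_mul_self, hq, one_mul]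
  simp only [re_mul, imI_mul, imJ_mul, imK_mul, re_star, imI_star, imJ_star, imK_star]
  linear_combination
    (2 * q.re ^ 2 - (q.re ^ 2 + q.imI ^ 2 + q.imJ ^ 2 + q.imK ^ 2)) * hP - hQ

/-- For unit quaternions `p` and `q`, the real part of the commutator
`star q * star p * q * p` is at least `2 (re q)² − 1`. -/
theorem re_commutator_ge (p q : Quaternion ℝ) (hp : ‖p‖ = 1) (hq : ‖q‖ = 1) :
    (star q * star p * q * p).re ≥ 2 * q.re ^ 2 - 1 := by
  rw [re_commutator_eq_add_sq p q hp hq]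
  exact le_add_of_nonneg_right (by positivity)
end

section
/- Let B and R be matrices in SO(3) with tr(B) ≥ 1. Then tr(B⁻¹·R⁻¹·B·R) ≥ (tr(B) − 1)² − 1. -/
open Matrix

/-- A denominator-free Rodrigues formula: a rotation with cosine `c` and sine-scaled axis
`w` satisfies `(1 + c) A = (1 + c) c + w wᵀ + (1 + c) [w]ₓ`. -/
theorem exists_rodrigues_of_SO3 (A : Matrix (Fin 3) (Fin 3) ℝ) (c : ℝ)
    (hA : Aᵀ * A = 1) (hdet : A.det = 1) (hc : A.trace = 1 + 2 * c) :
    ∃ x y z : ℝ, x ^ 2 + y ^ 2 + z ^ 2 = 1 - c ^ 2 ∧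
      (1 + c) • A = !![(1 + c) * c + x * x, x * y - (1 + c) * z, x * z + (1 + c) * y;
        x * y + (1 + c) * z, (1 + c) * c + y * y, y * z - (1 + c) * x;
        x * z - (1 + c) * y, y * z + (1 + c) * x, (1 + c) * c + z * z] := by
  have hA' : A * Aᵀ = 1 := mul_eq_one_comm.mp hA
  have hadj : A.adjugate = Aᵀ := by
    calc A.adjugate = (Aᵀ * A) * A.adjugate := by rw [hA, one_mul]
      _ = Aᵀ := by rw [mul_assoc, mul_adjugate, hdet, one_smul, mul_one]
  rw [adjugate_fin_three] at hadj
  have key (i j : Fin 3) := congrFun (congrFun hadj i) j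
  have row (i : Fin 3) := congrFun (congrFun hA' i) i
  have k00 := key 0 0
  have k01 := key 0 1
  have k02 := key 0 2
  have k10 := key 1 0
  have k11 := key 1 1
  have k12 := key 1 2
  have k20 := key 2 0
  have k21 := key 2 1
  have k22 := key 2 2
  have r0 := row 0
  have r1 := row 1
  have r2 := row 2
  clear key row hadj hA hA' hdet
  simp [mul_apply, Fin.sum_univ_three] at k00 k01 k02 k10 k11 k12 k20 k21 k22 r0 r1 r2
  rw [trace_fin_three] at hc
  have hc' : c = (A 0 0 + A 1 1 + A 2 2 - 1) / 2 := by linarith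
  subst hc'
  refine ⟨(A 2 1 - A 1 2) / 2, (A 0 2 - A 2 0) / 2, (A 1 0 - A 0 1) / 2, ?_, ?_⟩
  · grind
  · ext i j
    fin_cases i <;> fin_cases j <;> simp <;> grind

/-- Two rotations by the same angle `β ≤ π / 2` compose to a rotation by at most `2 β`. -/
theorem trace_mul_ge_of_SO3 (A C : Matrix (Fin 3) (Fin 3) ℝ)
    (hA : Aᵀ * A = 1) (hAdet : A.det = 1) (hC : Cᵀ * C = 1) (hCdet : C.det = 1)
    (htr : 1 ≤ A.trace) (h : C.trace = A.trace) :
    (A.trace - 1) ^ 2 - 1 ≤ (A * C).trace := by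
  obtain ⟨c, hc⟩ : ∃ c, A.trace = 1 + 2 * c := ⟨(A.trace - 1) / 2, by ring⟩
  have hc0 : 0 ≤ c := by linarith
  obtain ⟨x, y, z, hw, hA'⟩ := exists_rodrigues_of_SO3 A c hA hAdet hc
  obtain ⟨u, v, w, hv, hC'⟩ := exists_rodrigues_of_SO3 C c hC hCdet (h.trans hc)
  have ht : (1 + c) ^ 2 * (A * C).trace = (((1 + c) • A) * ((1 + c) • C)).trace := by
    rw [smul_mul_smul_comm, trace_smul, smul_eq_mul, sq]
  have hprod : (1 + c) ^ 2 * (A * C).trace = 3 * (1 + c) ^ 2 * c ^ 2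
      + (1 + c) * c * ((x ^ 2 + y ^ 2 + z ^ 2) + (u ^ 2 + v ^ 2 + w ^ 2))
      + (x * u + y * v + z * w) ^ 2 - 2 * (1 + c) ^ 2 * (x * u + y * v + z * w) := by
    rw [ht, hA', hC', trace_fin_three]
    simp [mul_apply, Fin.sum_univ_three]
    ring
  rw [hw, hv] at hprod
  have hle : x * u + y * v + z * w ≤ 1 - c ^ 2 := by
    nlinarith [sq_nonneg (x - u), sq_nonneg (y - v), sq_nonneg (z - w)]
  generalize x * u + y * v + z * w = s at hprod hle
  have hpos : 0 < (1 + c) ^ 2 := by positivity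
  refine le_of_mul_le_mul_left ?_ hpos
  have hfac : 0 ≤ (1 - c ^ 2 - s) * (2 * (1 + c) ^ 2 - (1 - c ^ 2) - s) :=
    mul_nonneg (by linarith) (by nlinarith)
  rw [hprod, hc]
  linarith

/-- For `B, R ∈ SO(3)` with `tr B ≥ 1`, the trace of the commutator satisfies
`tr (B⁻¹ R⁻¹ B R) ≥ (tr B − 1)² − 1`. -/
theorem trace_commutator_ge_SO3 (B R : Matrix (Fin 3) (Fin 3) ℝ)
    (hB : Bᵀ * B = 1) (hBdet : B.det = 1)
    (hR : Rᵀ * R = 1) (hRdet : R.det = 1)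
    (htr : 1 ≤ B.trace) :
    (B⁻¹ * R⁻¹ * B * R).trace ≥ (B.trace - 1) ^ 2 - 1 := by
  have hB' : B * Bᵀ = 1 := mul_eq_one_comm.mp hB
  have hR' : R * Rᵀ = 1 := mul_eq_one_comm.mp hR
  rw [inv_eq_left_inv hB, inv_eq_left_inv hR]
  have hC : (Rᵀ * B * R)ᵀ * (Rᵀ * B * R) = 1 := by
    calc (Rᵀ * B * R)ᵀ * (Rᵀ * B * R) = Rᵀ * (Bᵀ * ((R * Rᵀ) * B)) * R := by
          simp only [transpose_mul, transpose_transpose, mul_assoc]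
      _ = 1 := by rw [hR', one_mul, hB, mul_one, hR]
  have hCtr : (Rᵀ * B * R).trace = Bᵀ.trace := by
    rw [trace_mul_comm, ← mul_assoc, hR', one_mul, trace_transpose]
  have := trace_mul_ge_of_SO3 Bᵀ (Rᵀ * B * R) (by rwa [transpose_transpose])
    (by rwa [det_transpose]) hC (by simp [hBdet, hRdet]) (by rwa [trace_transpose]) hCtr
  simpa only [trace_transpose, mul_assoc] using this
end
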